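/- For every finite set S of points in the closed Euclidean unit ball {x ∈ ℝ³ : ‖x‖₂ ≤ 1}, there exists a wake-up tree for S rooted at the origin, with edge lengths measured by the Euclidean norm on ℝ³, whose makespan is at most 13·√3. -/

import Mathlib

/-- `IsWakeUpTree d p₀ S parent t` : `parent` encodes a rooted spanning tree on the node
node set `{p₀} ∪ S` (each non-root node has a parent among the nodes and reaches the root
by iterating `parent`), the root `p₀` has exactly one child (when there is a non-root
node), every non-root node has at most two children, and `t v` is the sum of the
`d`-distances along the tree path from `p₀` to `v` (so the makespan of the tree is the
maximum of `t` over the nodes). -/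
def IsWakeUpTree {X : Type*} (d : X → X → ℝ) (p₀ : X) (S : Finset X)
    (parent : X → X) (t : X → ℝ) : Prop :=
  t p₀ = 0 ∧
  (∀ p ∈ S, p ≠ p₀ →
      (parent p = p₀ ∨ parent p ∈ S) ∧
      t p = t (parent p) + d (parent p) p ∧
      ∃ n : ℕ, parent^[n] p = p₀) ∧
  -- the root has at most one child
  (∀ x ∈ S, x ≠ p₀ → parent x = p₀ →
      ∀ y ∈ S, y ≠ p₀ → parent y = p₀ → x = y) ∧
  -- the root has a child as soon as there is a non-root node
  ((∃ p ∈ S, p ≠ p₀) → ∃ c ∈ S, c ≠ p₀ ∧ parent c = p₀) ∧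
  -- every non-root node has at most two children
  (∀ q ∈ S, q ≠ p₀ → ∀ x ∈ S, ∀ y ∈ S, ∀ z ∈ S,
      x ≠ p₀ → y ≠ p₀ → z ≠ p₀ →
      parent x = q → parent y = q → parent z = q →
      x = y ∨ x = z ∨ y = z)

/-- Two wake-up trees rooted at `v` can be joined by an edge from a new root `p` to `v`. -/
theorem IsWakeUpTree.join {X : Type*} [DecidableEq X] {d : X → X → ℝ} {p v : X} {T₁ T₂ : Finset X}
    {par₁ par₂ : X → X} {t₁ t₂ : X → ℝ}
    (h₁ : IsWakeUpTree d v T₁ par₁ t₁) (h₂ : IsWakeUpTree d v T₂ par₂ t₂)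
    (hv₁ : v ∉ T₁) (hv₂ : v ∉ T₂) (hdisj : Disjoint T₁ T₂)
    (hpv : p ≠ v) (hp₁ : p ∉ T₁) (hp₂ : p ∉ T₂) :
    ∃ (par : X → X) (t : X → ℝ), IsWakeUpTree d p (insert v (T₁ ∪ T₂)) par t ∧
      t v = d p v ∧ (∀ x ∈ T₁, t x = d p v + t₁ x) ∧ (∀ x ∈ T₂, t x = d p v + t₂ x) := by
  obtain ⟨h0₁, hpar₁, huniq₁, -, htwo₁⟩ := h₁
  obtain ⟨h0₂, hpar₂, huniq₂, -, htwo₂⟩ := h₂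
  have hdis : ∀ x ∈ T₁, x ∉ T₂ := fun x hx hx' => Finset.disjoint_left.mp hdisj hx hx'
  let par : X → X := fun x => if x = v then p else if x ∈ T₁ then par₁ x else par₂ x
  let t : X → ℝ := fun x => if x = p then 0 else if x = v then d p v
    else if x ∈ T₁ then d p v + t₁ x else d p v + t₂ x
  have parv : par v = p := by simp [par]
  have parT₁ : ∀ x ∈ T₁, par x = par₁ x := by
    intro x hx
    have : x ≠ v := by grind
    simp [par, this, hx]
  have parT₂ : ∀ x ∈ T₂, par x = par₂ x := by
    intro x hx
    have : x ≠ v := by grind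
    have : x ∉ T₁ := by grind
    simp [par, *]
  have tp : t p = 0 := by simp [t]
  have tv : t v = d p v := by simp [t, hpv.symm]
  have tT₁ : ∀ x ∈ T₁, t x = d p v + t₁ x := by
    intro x hx
    have : x ≠ v := by grind
    have : x ≠ p := by grind
    simp [t, *]
  have tT₂ : ∀ x ∈ T₂, t x = d p v + t₂ x := by
    intro x hx
    have : x ≠ v := by grind
    have : x ≠ p := by grind
    have : x ∉ T₁ := by grind
    simp [t, *]
  have mem₁ : ∀ x ∈ T₁, par x = v ∨ par x ∈ T₁ := by grind
  have mem₂ : ∀ x ∈ T₂, par x = v ∨ par x ∈ T₂ := by grind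
  have iter₁ : ∀ n, ∀ x ∈ T₁, par₁^[n] x = v → ∃ m, par^[m] x = p := by
    intro n
    induction n with
    | zero => intro x hx h; exact absurd (h ▸ hx) hv₁
    | succ n ih =>
      intro x hx h
      rcases mem₁ x hx with h' | h'
      · exact ⟨2, by simp [h', parv]⟩
      · rw [Function.iterate_succ_apply, ← parT₁ x hx] at h
        obtain ⟨m, hm⟩ := ih _ h' h
        exact ⟨m + 1, hm⟩
  have iter₂ : ∀ n, ∀ x ∈ T₂, par₂^[n] x = v → ∃ m, par^[m] x = p := by
    intro n
    induction n with
    | zero => intro x hx h; exact absurd (h ▸ hx) hv₂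
    | succ n ih =>
      intro x hx h
      rcases mem₂ x hx with h' | h'
      · exact ⟨2, by simp [h', parv]⟩
      · rw [Function.iterate_succ_apply, ← parT₂ x hx] at h
        obtain ⟨m, hm⟩ := ih _ h' h
        exact ⟨m + 1, hm⟩
  clear_value par t
  refine ⟨par, t, ⟨tp, ?_, ?_, ?_, ?_⟩, tv, tT₁, tT₂⟩
  · intro x hx _
    simp only [Finset.mem_insert, Finset.mem_union] at hx ⊢
    rcases hx with rfl | hx | hx
    · exact ⟨Or.inl parv, by rw [parv, tp, tv, zero_add], 1, parv⟩
    · have hxv : x ≠ v := by grind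
      obtain ⟨-, ht, n, hn⟩ := hpar₁ x hx hxv
      refine ⟨by grind, ?_, iter₁ n x hx hn⟩
      rcases mem₁ x hx with h | h <;> grind
    · have hxv : x ≠ v := by grind
      obtain ⟨-, ht, n, hn⟩ := hpar₂ x hx hxv
      refine ⟨by grind, ?_, iter₂ n x hx hn⟩
      rcases mem₂ x hx with h | h <;> grind
  · have key : ∀ x ∈ insert v (T₁ ∪ T₂), par x = p → x = v := by
      intro x hx h
      simp only [Finset.mem_insert, Finset.mem_union] at hx
      rcases hx with rfl | hx | hx
      · rfl
      · have := mem₁ x hx; grind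
      · have := mem₂ x hx; grind
    intro x hx _ hxp y hy _ hyp
    rw [key x hx hxp, key y hy hyp]
  · exact fun _ => ⟨v, Finset.mem_insert_self _ _, hpv.symm, parv⟩
  · have key : ∀ q ≠ p, ∀ x ∈ insert v (T₁ ∪ T₂), par x = q →
        (x ∈ T₁ ∧ x ≠ v ∧ par₁ x = q ∧ (q = v ∨ q ∈ T₁)) ∨
        (x ∈ T₂ ∧ x ≠ v ∧ par₂ x = q ∧ (q = v ∨ q ∈ T₂)) := by
      intro q hq x hx h
      simp only [Finset.mem_insert, Finset.mem_union] at hx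
      rcases hx with rfl | hx | hx
      · exact absurd (parv.symm.trans h).symm hq
      · have := mem₁ x hx; grind
      · have := mem₂ x hx; grind
    intro q _ hqp x hx y hy z hz _ _ _ hxq hyq hzq
    have kx := key q hqp x hx hxq
    have ky := key q hqp y hy hyq
    have kz := key q hqp z hz hzq
    by_cases hqv : q = v
    · subst hqv
      rcases kx with ⟨a, a', a'', -⟩ | ⟨a, a', a'', -⟩ <;>
      rcases ky with ⟨b, b', b'', -⟩ | ⟨b, b', b'', -⟩ <;>
      rcases kz with ⟨c, c', c'', -⟩ | ⟨c, c', c'', -⟩ <;>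
      first
      | exact .inl (huniq₁ x a a' a'' y b b' b'')
      | exact .inl (huniq₂ x a a' a'' y b b' b'')
      | exact .inr (.inl (huniq₁ x a a' a'' z c c' c''))
      | exact .inr (.inl (huniq₂ x a a' a'' z c c' c''))
      | exact .inr (.inr (huniq₁ y b b' b'' z c c' c''))
      | exact .inr (.inr (huniq₂ y b b' b'' z c c' c''))
    · rcases kx with ⟨a, a', a'', hq⟩ | ⟨a, a', a'', hq⟩
      · have hq₁ := hq.resolve_left hqv
        have hq₂ := hdis q hq₁
        obtain ⟨b, b', b'', -⟩ := ky.resolve_right fun h => hq₂ (h.2.2.2.resolve_left hqv)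
        obtain ⟨c, c', c'', -⟩ := kz.resolve_right fun h => hq₂ (h.2.2.2.resolve_left hqv)
        exact htwo₁ q hq₁ hqv x a y b z c a' b' c' a'' b'' c''
      · have hq₂ := hq.resolve_left hqv
        have hq₁ : q ∉ T₁ := fun h => hdis q h hq₂
        obtain ⟨b, b', b'', -⟩ := ky.resolve_left fun h => hq₁ (h.2.2.2.resolve_left hqv)
        obtain ⟨c, c', c'', -⟩ := kz.resolve_left fun h => hq₁ (h.2.2.2.resolve_left hqv)
        exact htwo₂ q hq₂ hqv x a y b z c a' b' c' a'' b'' c''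

theorem IsWakeUpTree.of_erase_root {X : Type*} [DecidableEq X] {d : X → X → ℝ} {p : X}
    {S : Finset X}
    {par : X → X} {t : X → ℝ} (h : IsWakeUpTree d p (S.erase p) par t) :
    IsWakeUpTree d p S par t := by
  obtain ⟨h0, hpar, huniq, hex, htwo⟩ := h
  refine ⟨h0, ?_, ?_, ?_, ?_⟩
  · intro x hx hxp
    obtain ⟨h, h'⟩ := hpar x (by simp [hx, hxp]) hxp
    exact ⟨h.imp_right Finset.mem_of_mem_erase, h'⟩
  · intro x hx hxp h y hy hyp h'
    exact huniq x (by simp [hx, hxp]) hxp h y (by simp [hy, hyp]) hyp h'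
  · rintro ⟨x, hx, hxp⟩
    obtain ⟨c, hc, h⟩ := hex ⟨x, by simp [hx, hxp], hxp⟩
    exact ⟨c, Finset.mem_of_mem_erase hc, h⟩
  · intro q hq hqp x hx y hy z hz hxp hyp hzp
    exact htwo q (by simp [hq, hqp]) hqp x (by simp [hx, hxp]) y (by simp [hy, hyp])
      z (by simp [hz, hzp]) hxp hyp hzp

/-- Wake-up trees by repeated bisection: if every finite set of class `K n` has diameter at most
`δ n` and splits into two sets of class `K (n + 1)`, then every set of class `K n` within distance
`a` of `p` has a wake-up tree rooted at `p` of makespan at most `a + B n`, for any nonnegative `B`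
with `δ n + B (n + 1) ≤ B n`. -/
theorem exists_isWakeUpTree_of_bisection {X : Type*} [DecidableEq X] {d : X → X → ℝ}
    {K : ℕ → Finset X → Prop} {δ B : ℕ → ℝ}
    (hmono : ∀ n S T, S ⊆ T → K n T → K n S)
    (hsplit : ∀ n T, K n T → ∃ U ⊆ T, K (n + 1) U ∧ K (n + 1) (T \ U))
    (hdiam : ∀ n T, K n T → ∀ x ∈ T, ∀ y ∈ T, d x y ≤ δ n)
    (hB : ∀ n, 0 ≤ B n) (hδB : ∀ n, δ n + B (n + 1) ≤ B n)
    (T : Finset X) (n : ℕ) (p : X) (a : ℝ) (hT : K n T) (hp : p ∉ T)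
    (ha : ∀ x ∈ T, d p x ≤ a) :
    ∃ (par : X → X) (t : X → ℝ), IsWakeUpTree d p T par t ∧ ∀ x ∈ T, t x ≤ a + B n := by
  induction T using Finset.strongInduction generalizing n p a with
  | H T ih =>
  rcases T.eq_empty_or_nonempty with rfl | ⟨v, hv⟩
  · exact ⟨id, 0, by simp [IsWakeUpTree], by simp⟩
  have hsub := Finset.erase_subset v T
  obtain ⟨U, hU, hKU, hKV⟩ := hsplit n _ (hmono n _ _ hsub hT)
  have hlt : T.erase v ⊂ T := Finset.erase_ssubset hv
  have hvU : v ∉ U := fun h => Finset.notMem_erase v T (hU h)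
  have hvV : v ∉ T.erase v \ U := by simp
  obtain ⟨par₁, t₁, h₁, ht₁⟩ := ih U (hU.trans_ssubset hlt) (n + 1) v (δ n) hKU hvU
    fun x hx => hdiam n T hT v hv x (hsub (hU hx))
  obtain ⟨par₂, t₂, h₂, ht₂⟩ := ih _ (Finset.sdiff_subset.trans_ssubset hlt) (n + 1) v (δ n) hKV
    hvV fun x hx => hdiam n T hT v hv x (hsub (Finset.sdiff_subset hx))
  have heq : insert v (U ∪ (T.erase v \ U)) = T := by
    rw [Finset.union_sdiff_of_subset hU, Finset.insert_erase hv]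
  obtain ⟨par, t, h, htv, hU', hV'⟩ := h₁.join (p := p) h₂ hvU hvV Finset.disjoint_sdiff
    (fun h => hp (h ▸ hv)) (fun h => hp (hsub (hU h)))
    (fun h => hp (hsub (Finset.sdiff_subset h)))
  rw [heq] at h
  refine ⟨par, t, h, fun x hx => ?_⟩
  have hpv := ha v hv
  rw [← heq, Finset.mem_insert, Finset.mem_union] at hx
  rcases hx with rfl | hx | hx
  · linarith [hB n]
  · linarith [hU' x hx, ht₁ x hx, hδB n]
  · linarith [hV' x hx, ht₂ x hx, hδB n]

/-- Half-width along axis `i` of the boxes obtained from the cube `[-1, 1]³` after `n` bisections,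
performed cyclically along the axes `0, 1, 2`. -/
noncomputable def boxHalfWidth (n : ℕ) (i : Fin 3) : ℝ := (1 / 2) ^ ((n + 2 - i.val) / 3)

theorem boxHalfWidth_eq {n k : ℕ} {i : Fin 3} (h : (n + 2 - i.val) / 3 = k) :
    boxHalfWidth n i = (1 / 2) ^ k := by
  rw [boxHalfWidth, h]

theorem boxHalfWidth_succ (n : ℕ) (i : Fin 3) :
    boxHalfWidth (n + 1) i = if n % 3 = i then boxHalfWidth n i / 2 else boxHalfWidth n i := by
  have hi := i.isLt
  unfold boxHalfWidth
  split_ifs with h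
  · have : (n + 1 + 2 - i.val) / 3 = (n + 2 - i.val) / 3 + 1 := by omega
    rw [this, pow_succ]; ring
  · have : (n + 1 + 2 - i.val) / 3 = (n + 2 - i.val) / 3 := by omega
    rw [this]

/-- The set `T` lies in a box obtained from a translate of `[-1, 1]³` by `n` bisections. -/
def InBox (n : ℕ) (T : Finset (EuclideanSpace ℝ (Fin 3))) : Prop :=
  ∃ c : Fin 3 → ℝ, ∀ x ∈ T, ∀ i, |x i - c i| ≤ boxHalfWidth n i

theorem InBox.split {n : ℕ} {T : Finset (EuclideanSpace ℝ (Fin 3))} (h : InBox n T) :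
    ∃ U ⊆ T, InBox (n + 1) U ∧ InBox (n + 1) (T \ U) := by
  obtain ⟨c, hc⟩ := h
  let j : Fin 3 := ⟨n % 3, Nat.mod_lt _ (by norm_num)⟩
  have hj : ∀ i : Fin 3, n % 3 = i ↔ i = j := fun i => by simp [j, Fin.ext_iff, eq_comm]
  refine ⟨T.filter (fun x => x j ≤ c j), Finset.filter_subset _ _,
    ⟨Function.update c j (c j - boxHalfWidth n j / 2), ?_⟩,
    ⟨Function.update c j (c j + boxHalfWidth n j / 2), ?_⟩⟩
  all_goals
    intro x hx i
    have hx' : x ∈ T := by simp only [Finset.mem_filter, Finset.mem_sdiff] at hx; exact hx.1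
    have hxi := hc x hx' i
    rw [boxHalfWidth_succ]
    simp only [hj]
    split_ifs with hij
    · subst hij
      rw [Function.update_self]
      simp only [Finset.mem_filter, Finset.mem_sdiff, not_and, not_le] at hx
      rw [abs_le] at hxi ⊢
      obtain ⟨hlo, hhi⟩ := hxi
      first
      | have := hx.2
        constructor <;> linarith
      | have := hx.2 hx'
        constructor <;> linarith
    · rwa [Function.update_of_ne hij]

/-- An upper bound for the diameter of the boxes obtained from `[-1, 1]³` by `n` bisections. -/
noncomputable def boxDiam (n : ℕ) : ℝ :=
  (1 / 2) ^ (n / 3) * (if n % 3 = 0 then 7 / 2 else if n % 3 = 1 then 3 else 5 / 2)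

theorem InBox.dist_le {n : ℕ} {T : Finset (EuclideanSpace ℝ (Fin 3))} (h : InBox n T)
    {x y : EuclideanSpace ℝ (Fin 3)} (hx : x ∈ T) (hy : y ∈ T) : dist x y ≤ boxDiam n := by
  obtain ⟨c, hc⟩ := h
  have hw : ∀ i, (x i - y i) ^ 2 ≤ (2 * boxHalfWidth n i) ^ 2 := by
    intro i
    have h1 := abs_le.mp (hc x hx i)
    have h2 := abs_le.mp (hc y hy i)
    exact sq_le_sq' (by linarith) (by linarith)
  rw [EuclideanSpace.dist_eq]
  have hnn : 0 ≤ boxDiam n := by unfold boxDiam; positivity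
  refine Real.sqrt_le_iff.mpr ⟨hnn, ?_⟩
  simp only [Real.dist_eq, sq_abs, Fin.sum_univ_three]
  have h0 := hw 0
  have h1 := hw 1
  have h2 := hw 2
  obtain ⟨k, hk⟩ : ∃ k, n / 3 = k := ⟨_, rfl⟩
  have hcases : n = 3 * k ∨ n = 3 * k + 1 ∨ n = 3 * k + 2 := by omega
  have hpos : (0 : ℝ) ≤ ((1 / 2) ^ k) ^ 2 := by positivity
  rcases hcases with rfl | rfl | rfl
  · have e0 : boxHalfWidth (3 * k) 0 = (1 / 2) ^ k :=
      boxHalfWidth_eq (show (3 * k + 2 - 0) / 3 = k by omega)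
    have e1 : boxHalfWidth (3 * k) 1 = (1 / 2) ^ k :=
      boxHalfWidth_eq (show (3 * k + 2 - 1) / 3 = k by omega)
    have e2 : boxHalfWidth (3 * k) 2 = (1 / 2) ^ k :=
      boxHalfWidth_eq (show (3 * k + 2 - 2) / 3 = k by omega)
    have eD : boxDiam (3 * k) = (1 / 2) ^ k * (7 / 2) := by simp [boxDiam]
    rw [e0] at h0; rw [e1] at h1; rw [e2] at h2; rw [eD]
    nlinarith
  · have e0 : boxHalfWidth (3 * k + 1) 0 = (1 / 2) ^ k * (1 / 2) :=
      (boxHalfWidth_eq (show (3 * k + 1 + 2 - 0) / 3 = k + 1 by omega)).trans (pow_succ _ _)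
    have e1 : boxHalfWidth (3 * k + 1) 1 = (1 / 2) ^ k :=
      boxHalfWidth_eq (show (3 * k + 1 + 2 - 1) / 3 = k by omega)
    have e2 : boxHalfWidth (3 * k + 1) 2 = (1 / 2) ^ k :=
      boxHalfWidth_eq (show (3 * k + 1 + 2 - 2) / 3 = k by omega)
    have eD : boxDiam (3 * k + 1) = (1 / 2) ^ k * 3 := by
      unfold boxDiam; rw [hk, if_neg (by omega), if_pos (by omega)]
    rw [e0] at h0; rw [e1] at h1; rw [e2] at h2; rw [eD]
    nlinarith
  · have e0 : boxHalfWidth (3 * k + 2) 0 = (1 / 2) ^ k * (1 / 2) :=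
      (boxHalfWidth_eq (show (3 * k + 2 + 2 - 0) / 3 = k + 1 by omega)).trans (pow_succ _ _)
    have e1 : boxHalfWidth (3 * k + 2) 1 = (1 / 2) ^ k * (1 / 2) :=
      (boxHalfWidth_eq (show (3 * k + 2 + 2 - 1) / 3 = k + 1 by omega)).trans (pow_succ _ _)
    have e2 : boxHalfWidth (3 * k + 2) 2 = (1 / 2) ^ k :=
      boxHalfWidth_eq (show (3 * k + 2 + 2 - 2) / 3 = k by omega)
    have eD : boxDiam (3 * k + 2) = (1 / 2) ^ k * (5 / 2) := by
      unfold boxDiam; rw [hk, if_neg (by omega), if_neg (by omega)]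
    rw [e0] at h0; rw [e1] at h1; rw [e2] at h2; rw [eD]
    nlinarith

/-- The sum of `boxDiam m` over all `m ≥ n`. -/
noncomputable def boxDiamTail (n : ℕ) : ℝ :=
  (1 / 2) ^ (n / 3) * (if n % 3 = 0 then 18 else if n % 3 = 1 then 29 / 2 else 23 / 2)

theorem boxDiam_add_boxDiamTail_succ (n : ℕ) :
    boxDiam n + boxDiamTail (n + 1) = boxDiamTail n := by
  unfold boxDiam boxDiamTail
  have hcases : n % 3 = 0 ∨ n % 3 = 1 ∨ n % 3 = 2 := by omega
  rcases hcases with h | h | h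
  · rw [show (n + 1) / 3 = n / 3 by omega, show (n + 1) % 3 = 1 by omega, h]
    norm_num; ring
  · rw [show (n + 1) / 3 = n / 3 by omega, show (n + 1) % 3 = 2 by omega, h]
    norm_num; ring
  · rw [show (n + 1) / 3 = n / 3 + 1 by omega, show (n + 1) % 3 = 0 by omega, h, pow_succ]
    norm_num; ring

/-- any finite set of points in the closed Euclidean unit ball of `ℝ³`
admits a wake-up tree rooted at the origin with makespan at most `13·√3`. -/
theorem freezeTag_l2Ball_R3_makespan_le (S : Finset (EuclideanSpace ℝ (Fin 3)))
    (hS : ∀ p ∈ S, ‖p‖ ≤ 1) :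
    ∃ (parent : EuclideanSpace ℝ (Fin 3) → EuclideanSpace ℝ (Fin 3))
      (t : EuclideanSpace ℝ (Fin 3) → ℝ),
      IsWakeUpTree dist (0 : EuclideanSpace ℝ (Fin 3)) S parent t ∧
      ∀ p ∈ S, t p ≤ 13 * Real.sqrt 3 := by
  have hbox : InBox 0 (S.erase 0) := by
    refine ⟨0, fun x hx i => ?_⟩
    have h1 : |x i| ≤ ‖x‖ := by simpa using PiLp.norm_apply_le x i
    have h2 : boxHalfWidth 0 i = 1 := by
      unfold boxHalfWidth
      rw [Nat.div_eq_of_lt (by omega), pow_zero]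
    simpa [h2] using h1.trans (hS x (Finset.mem_of_mem_erase hx))
  obtain ⟨par, t, h, ht⟩ := exists_isWakeUpTree_of_bisection (d := dist) (K := InBox)
    (fun n U T hUT ⟨c, hc⟩ => ⟨c, fun x hx => hc x (hUT hx)⟩)
    (fun n T hT => hT.split) (fun n T hT x hx y hy => hT.dist_le hx hy)
    (fun n => show 0 ≤ boxDiamTail n by unfold boxDiamTail; positivity)
    (fun n => (boxDiam_add_boxDiamTail_succ n).le)
    (S.erase 0) 0 0 1 hbox (Finset.notMem_erase 0 S)
    (fun x hx => by simpa using hS x (Finset.mem_of_mem_erase hx))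
  refine ⟨par, t, h.of_erase_root, fun p hp => ?_⟩
  by_cases hp0 : p = 0
  · rw [hp0, h.1]; positivity
  · have hsqrt : (3 / 2 : ℝ) ≤ Real.sqrt 3 := Real.le_sqrt_of_sq_le (by norm_num)
    have htail : boxDiamTail 0 = 18 := by simp [boxDiamTail]
    linarith [ht p (Finset.mem_erase.mpr ⟨hp0, hp⟩)]
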